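/- Idempotency of the PFIBM operator: Let T be a strict t-norm with additive generator τ, p, q > 0, and α a PFN. If α₁ = α₂ = ... = αₙ = α (n ≥ 2), then PFIBM_T^{p,q}(α₁,...,αₙ) = [ (1/(n(n−1))) · ⊕_{i≠j} (αᵢ^p ⊗ αⱼ^q) ]^{1/(p+q)} = α. -/

import Mathlib

open Set ENNReal

/-- A picture fuzzy number: a triple (μ, η, ν) ∈ [0,1]³ with μ + η + ν ≤ 1. -/
def IsPFN (a : ℝ × ℝ × ℝ) : Prop :=
  a.1 ∈ Icc (0:ℝ) 1 ∧ a.2.1 ∈ Icc (0:ℝ) 1 ∧ a.2.2 ∈ Icc (0:ℝ) 1 ∧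
    a.1 + a.2.1 + a.2.2 ≤ 1

/-- `τ : [0,1] → [0,∞]` is an additive generator of a strict t-norm:
a continuous strictly decreasing bijection with `τ 1 = 0`, `τ 0 = ∞`;
`σ` is its inverse (taking values in `[0,1]`). -/
structure IsStrictGenerator (τ : ℝ → ℝ≥0∞) (σ : ℝ≥0∞ → ℝ) : Prop where
  anti : StrictAntiOn τ (Icc (0:ℝ) 1)
  cont : ContinuousOn τ (Icc (0:ℝ) 1)
  map_one : τ 1 = 0
  map_zero : τ 0 = ⊤
  left_inv : ∀ x ∈ Icc (0:ℝ) 1, σ (τ x) = x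
  right_inv : ∀ y, τ (σ y) = y
  mem : ∀ y, σ y ∈ Icc (0:ℝ) 1

/-- `ζ x = τ (1 - x)`, an additive generator of the dual t-conorm. -/
noncomputable def zeta (τ : ℝ → ℝ≥0∞) (x : ℝ) : ℝ≥0∞ := τ (1 - x)

/-- `ζ⁻¹ y = 1 - σ y`, the inverse of `ζ`. -/
noncomputable def zetaInv (σ : ℝ≥0∞ → ℝ) (y : ℝ≥0∞) : ℝ := 1 - σ y

/-- The PFN addition `α ⊕ β` induced by the strict t-norm with generator `τ`. -/
noncomputable def oplusG (τ : ℝ → ℝ≥0∞) (σ : ℝ≥0∞ → ℝ) (a b : ℝ × ℝ × ℝ) :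
    ℝ × ℝ × ℝ :=
  (zetaInv σ (zeta τ a.1 + zeta τ b.1),
   σ (τ (a.2.1 + a.2.2) + τ (b.2.1 + b.2.2)) - σ (τ a.2.2 + τ b.2.2),
   σ (τ a.2.2 + τ b.2.2))

/-- The PFN product `α ⊗ β` induced by the strict t-norm with generator `τ`. -/
noncomputable def otimesG (τ : ℝ → ℝ≥0∞) (σ : ℝ≥0∞ → ℝ) (a b : ℝ × ℝ × ℝ) :
    ℝ × ℝ × ℝ :=
  (σ (τ a.1 + τ b.1),
   σ (τ (a.2.1 + a.1) + τ (b.2.1 + b.1)) - σ (τ a.1 + τ b.1),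
   zetaInv σ (zeta τ a.2.2 + zeta τ b.2.2))

/-- Scalar multiplication `λ · α` of a PFN triple. -/
noncomputable def smulG (τ : ℝ → ℝ≥0∞) (σ : ℝ≥0∞ → ℝ) (l : ℝ) (a : ℝ × ℝ × ℝ) :
    ℝ × ℝ × ℝ :=
  (zetaInv σ (ENNReal.ofReal l * zeta τ a.1),
   σ (ENNReal.ofReal l * τ (a.2.1 + a.2.2)) - σ (ENNReal.ofReal l * τ a.2.2),
   σ (ENNReal.ofReal l * τ a.2.2))

/-- Power `α ^ λ` of a PFN triple. -/
noncomputable def ppowG (τ : ℝ → ℝ≥0∞) (σ : ℝ≥0∞ → ℝ) (l : ℝ) (a : ℝ × ℝ × ℝ) :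
    ℝ × ℝ × ℝ :=
  (σ (ENNReal.ofReal l * τ a.1),
   σ (ENNReal.ofReal l * τ (a.2.1 + a.1)) - σ (ENNReal.ofReal l * τ a.1),
   zetaInv σ (ENNReal.ofReal l * zeta τ a.2.2))

/-- The picture fuzzy interactional Bonferroni mean
`PFIBM_T^{p,q}(α₁,…,αₙ) = [ (1/(n(n-1))) ⊕_{i≠j} (αᵢ^p ⊗ αⱼ^q) ]^{1/(p+q)}`,
where the `⊕` over all ordered pairs `i ≠ j` is the iterated PFN addition. -/
noncomputable def PFIBM (τ : ℝ → ℝ≥0∞) (σ : ℝ≥0∞ → ℝ) (p q : ℝ) (n : ℕ)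
    (α : Fin n → ℝ × ℝ × ℝ) : ℝ × ℝ × ℝ :=
  let terms : List (ℝ × ℝ × ℝ) :=
    (List.finRange n).flatMap fun i =>
      ((List.finRange n).filter fun j => decide (j ≠ i)).map fun j =>
        otimesG τ σ (ppowG τ σ p (α i)) (ppowG τ σ q (α j))
  ppowG τ σ (1 / (p + q))
    (smulG τ σ (1 / ((n : ℝ) * ((n : ℝ) - 1)))
      (match terms with
       | [] => ((0 : ℝ), (0 : ℝ), (1 : ℝ))
       | h :: t => t.foldl (oplusG τ σ) h))

theorem sg_anti {τ : ℝ → ℝ≥0∞} {σ : ℝ≥0∞ → ℝ} (hg : IsStrictGenerator τ σ)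
    {x y : ℝ≥0∞} (h : x ≤ y) : σ y ≤ σ x := by
  by_contra hc
  push Not at hc
  have := hg.anti (hg.mem x) (hg.mem y) hc
  rw [hg.right_inv, hg.right_inv] at this
  exact absurd h (not_le.mpr this)

theorem smulG_smulG {τ : ℝ → ℝ≥0∞} {σ : ℝ≥0∞ → ℝ} (hg : IsStrictGenerator τ σ)
    (l m : ℝ) (hl : 0 ≤ l) (b : ℝ × ℝ × ℝ) :
    smulG τ σ l (smulG τ σ m b) = smulG τ σ (l * m) b := by
  simp [smulG, zeta, zetaInv, hg.right_inv, ENNReal.ofReal_mul hl, mul_assoc]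

theorem ppowG_ppowG {τ : ℝ → ℝ≥0∞} {σ : ℝ≥0∞ → ℝ} (hg : IsStrictGenerator τ σ)
    (l m : ℝ) (hl : 0 ≤ l) (b : ℝ × ℝ × ℝ) :
    ppowG τ σ l (ppowG τ σ m b) = ppowG τ σ (l * m) b := by
  simp [ppowG, zeta, zetaInv, hg.right_inv, ENNReal.ofReal_mul hl, mul_assoc]

theorem otimesG_ppowG {τ : ℝ → ℝ≥0∞} {σ : ℝ≥0∞ → ℝ} (hg : IsStrictGenerator τ σ)
    (p q : ℝ) (hp : 0 ≤ p) (hq : 0 ≤ q) (b : ℝ × ℝ × ℝ) :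
    otimesG τ σ (ppowG τ σ p b) (ppowG τ σ q b) = ppowG τ σ (p + q) b := by
  simp [otimesG, ppowG, zeta, zetaInv, hg.right_inv, ENNReal.ofReal_add hp hq, add_mul]

theorem oplusG_smulG {τ : ℝ → ℝ≥0∞} {σ : ℝ≥0∞ → ℝ} (hg : IsStrictGenerator τ σ)
    (l : ℝ) (hl : 0 ≤ l) (b : ℝ × ℝ × ℝ) :
    oplusG τ σ (smulG τ σ l b) b = smulG τ σ (l + 1) b := by
  simp [oplusG, smulG, zeta, zetaInv, hg.right_inv, ENNReal.ofReal_add hl zero_le_one, add_mul]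

theorem smulG_one {τ : ℝ → ℝ≥0∞} {σ : ℝ≥0∞ → ℝ} (hg : IsStrictGenerator τ σ)
    (b : ℝ × ℝ × ℝ) (hb : IsPFN b) : smulG τ σ 1 b = b := by
  obtain ⟨x, y, z⟩ := b
  obtain ⟨⟨h1, h2⟩, ⟨h3, h4⟩, ⟨h5, h6⟩, h7⟩ := hb
  simp only at *
  simp only [smulG, zeta, zetaInv, ENNReal.ofReal_one, one_mul]
  rw [hg.left_inv (1 - x) ⟨by linarith, by linarith⟩,
    hg.left_inv (y + z) ⟨by linarith, by linarith⟩, hg.left_inv z ⟨h5, h6⟩]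
  simp

theorem ppowG_one {τ : ℝ → ℝ≥0∞} {σ : ℝ≥0∞ → ℝ} (hg : IsStrictGenerator τ σ)
    (b : ℝ × ℝ × ℝ) (hb : IsPFN b) : ppowG τ σ 1 b = b := by
  obtain ⟨x, y, z⟩ := b
  obtain ⟨⟨h1, h2⟩, ⟨h3, h4⟩, ⟨h5, h6⟩, h7⟩ := hb
  simp only at *
  simp only [ppowG, zeta, zetaInv, ENNReal.ofReal_one, one_mul]
  rw [hg.left_inv (1 - z) ⟨by linarith, by linarith⟩,
    hg.left_inv (y + x) ⟨by linarith, by linarith⟩, hg.left_inv x ⟨h1, h2⟩]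
  simp

theorem ppowG_isPFN {τ : ℝ → ℝ≥0∞} {σ : ℝ≥0∞ → ℝ} (hg : IsStrictGenerator τ σ)
    (l : ℝ) (b : ℝ × ℝ × ℝ) (hb : IsPFN b) : IsPFN (ppowG τ σ l b) := by
  obtain ⟨x, y, z⟩ := b
  obtain ⟨⟨h1, h2⟩, ⟨h3, h4⟩, ⟨h5, h6⟩, h7⟩ := hb
  simp only at *
  have a1 : τ (y + x) ≤ τ x :=
    hg.anti.antitoneOn ⟨h1, h2⟩ ⟨by linarith, by linarith⟩ (by linarith)
  have a2 : τ (1 - z) ≤ τ (y + x) :=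
    hg.anti.antitoneOn ⟨by linarith, by linarith⟩ ⟨by linarith, by linarith⟩ (by linarith)
  have b1 := sg_anti hg (mul_le_mul_right a1 (ENNReal.ofReal l))
  have b2 := sg_anti hg (mul_le_mul_right a2 (ENNReal.ofReal l))
  have c1 := hg.mem (ENNReal.ofReal l * τ x)
  have c2 := hg.mem (ENNReal.ofReal l * τ (y + x))
  have c3 := hg.mem (ENNReal.ofReal l * τ (1 - z))
  simp only [Set.mem_Icc] at c1 c2 c3
  simp only [IsPFN, ppowG, zeta, zetaInv, Set.mem_Icc]
  refine ⟨⟨?_, ?_⟩, ⟨?_, ?_⟩, ⟨?_, ?_⟩, ?_⟩ <;> linarith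

theorem foldl_oplusG {τ : ℝ → ℝ≥0∞} {σ : ℝ≥0∞ → ℝ} (hg : IsStrictGenerator τ σ)
    (b : ℝ × ℝ × ℝ) (k : ℕ) (l : ℝ) (hl : 0 ≤ l) :
    (List.replicate k b).foldl (oplusG τ σ) (smulG τ σ l b) = smulG τ σ (l + k) b := by
  induction k generalizing l with
  | zero => simp
  | succ k ih =>
    rw [List.replicate_succ, List.foldl_cons, oplusG_smulG hg l hl, ih (l + 1) (by linarith)]
    congr 1
    push_cast
    ring

theorem terms_eq (n : ℕ) (b : ℝ × ℝ × ℝ) :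
    ((List.finRange n).flatMap fun i =>
      ((List.finRange n).filter fun j => decide (j ≠ i)).map fun _ => b)
      = List.replicate (n * (n - 1)) b := by
  have hf : ∀ i : Fin n, ((List.finRange n).filter fun j => decide (j ≠ i)).length = n - 1 := by
    intro i
    have h := (List.nodup_finRange n).erase_eq_filter i
    have h2 := List.length_erase_of_mem (List.mem_finRange i)
    rw [h] at h2
    rw [List.length_finRange] at h2
    rw [← h2]
    congr 1
    apply List.filter_congr
    intro x _
    by_cases hx : x = i <;> simp [hx]
  rw [List.eq_replicate_iff]
  refine ⟨?_, ?_⟩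
  · rw [List.length_flatMap]
    simp only [List.length_map, hf]
    simp
  · intro c hc
    simp only [List.mem_flatMap, List.mem_map] at hc
    obtain ⟨_, _, _, _, h⟩ := hc
    exact h.symm

/-- idempotency of the PFIBM operator. -/
theorem PFIBM_idempotent (τ : ℝ → ℝ≥0∞) (σ : ℝ≥0∞ → ℝ)
    (hg : IsStrictGenerator τ σ) (p q : ℝ) (hp : 0 < p) (hq : 0 < q)
    (n : ℕ) (hn : 2 ≤ n) (α : Fin n → ℝ × ℝ × ℝ) (a : ℝ × ℝ × ℝ)
    (ha : IsPFN a) (hα : ∀ i, α i = a) :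
    PFIBM τ σ p q n α = a := by
  have hpq : 0 < p + q := by linarith
  obtain ⟨m, rfl⟩ : ∃ m, n = m + 2 := ⟨n - 2, by omega⟩
  have hN : (m + 2) * (m + 2 - 1) = ((m + 2) * (m + 1) - 1) + 1 := by
    have : 0 < (m + 2) * (m + 1) := by positivity
    have h2 : m + 2 - 1 = m + 1 := by omega
    rw [h2]; omega
  have hb := ppowG_isPFN hg (p + q) a ha
  unfold PFIBM
  simp only [hα, otimesG_ppowG hg p q hp.le hq.le]
  rw [terms_eq, hN, List.replicate_succ]
  simp only
  have key := foldl_oplusG hg (ppowG τ σ (p + q) a) ((m + 2) * (m + 1) - 1) 1 zero_le_one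
  rw [smulG_one hg _ hb] at key
  have hpos : (0 : ℝ) < ((m + 2 : ℕ) : ℝ) * (((m + 2 : ℕ) : ℝ) - 1) := by
    push_cast
    have : (0 : ℝ) ≤ m := m.cast_nonneg
    nlinarith
  have hc : (1 : ℝ) + (((m + 2) * (m + 1) - 1 : ℕ) : ℝ)
      = ((m + 2 : ℕ) : ℝ) * (((m + 2 : ℕ) : ℝ) - 1) := by
    rw [Nat.cast_sub (Nat.succ_le_of_lt (by positivity))]
    push_cast
    ring
  rw [key, hc, smulG_smulG hg _ _ (by positivity), one_div_mul_cancel hpos.ne',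
    smulG_one hg _ hb, ppowG_ppowG hg _ _ (by positivity), one_div_mul_cancel hpq.ne',
    ppowG_one hg _ ha]
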